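/- Assume A + κ ≥ 1, let θ < b < 1 and T ≥ 6. Then the set Z(b;T−1,T+1) of zeros of ζ with real part at least b and imaginary part of absolute value between T−1 and T+1 is finite, and #Z(b;T−1,T+1) ≤ (1/(b−θ))·( 6.2·log T + 6.2·log( (A+κ)²/(b−θ) ) + 24 ). -/

import Mathlib

open scoped BigOperators Real

/-- The multiplicative norm on the Beurling generalized integers `ℕ →₀ ℕ`
generated by the primes `q i`. -/
noncomputable def bNorm (q : ℕ → ℝ) (g : ℕ →₀ ℕ) : ℝ :=
  g.prod fun i k => q i ^ k

/-- The integer counting function `N(x)`. -/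
noncomputable def bN (q : ℕ → ℝ) (x : ℝ) : ℕ :=
  {g : ℕ →₀ ℕ | bNorm q g ≤ x}.ncard

/-- The remainder `R(x) = N(x) - κ(x-1)`. -/
noncomputable def bR (q : ℕ → ℝ) (κ : ℝ) (x : ℝ) : ℝ :=
  (bN q x : ℝ) - κ * (x - 1)

/-- The Beurling zeta function, via the analytic continuation formula
`ζ(s) = κ/(s-1) + s ∫_1^∞ R(x) x^(-s-1) dx`. -/
noncomputable def bZeta (q : ℕ → ℝ) (κ : ℝ) (s : ℂ) : ℂ :=
  (κ : ℂ) / (s - 1) + s * ∫ x in Set.Ioi (1 : ℝ), (bR q κ x : ℂ) * (x : ℂ) ^ (-s - 1)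

/-- The partial sums `ζ_X(s) = ∑_{‖g‖ ≤ X} ‖g‖^{-s}`. -/
noncomputable def bZetaX (q : ℕ → ℝ) (X : ℝ) (s : ℂ) : ℂ :=
  ∑ᶠ g ∈ {g : ℕ →₀ ℕ | bNorm q g ≤ X}, (bNorm q g : ℂ) ^ (-s)

open Complex ComplexConjugate in
/-- The reflection of `ρ` in the line `re = a` differs from `s`. -/
theorem norm_add_conj_sub_pos {a : ℝ} {s ρ : ℂ} (hs : a < s.re) (hρ : a < ρ.re) :
    0 < ‖s + conj ρ - 2 * a‖ := by
  refine norm_pos_iff.2 fun h => ?_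
  have := congrArg Complex.re h
  simp at this
  linarith

open Complex ComplexConjugate in
/-- The Schwarz lemma in a half-plane. -/
theorem norm_mul_norm_le_of_eq_zero_of_halfPlane {F : ℂ → ℂ} {a M : ℝ}
    (hd : DifferentiableOn ℂ F {s | a < s.re}) (hM : ∀ s : ℂ, a < s.re → ‖F s‖ ≤ M)
    {ρ s : ℂ} (hρ : a < ρ.re) (h0 : F ρ = 0) (hs : a < s.re) :
    ‖F s‖ * ‖s + conj ρ - 2 * a‖ ≤ M * ‖s - ρ‖ := by
  set φ : ℂ → ℂ := fun w => (ρ + w * (conj ρ - 2 * a)) / (1 - w) with hφ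
  have hne : ∀ w : ℂ, ‖w‖ < 1 → 1 - w ≠ 0 := by
    rintro w hw h
    rw [← sub_eq_zero.1 h] at hw
    simp at hw
  have hre : ∀ w : ℂ, ‖w‖ < 1 → a < (φ w).re := by
    intro w hw
    have h1 := hne w hw
    have h2 : φ w - a = (ρ - a + w * conj (ρ - a)) * conj (1 - w) / (normSq (1 - w) : ℝ) := by
      rw [Complex.normSq_eq_conj_mul_self]
      have h3 : conj (1 - w) ≠ 0 := (map_ne_zero _).2 h1
      simp only [hφ]
      field_simp
      simp
      ring
    have h4 : 0 < normSq (1 - w) := Complex.normSq_pos.2 h1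
    have h5 : (φ w).re - a = (ρ.re - a) * (1 - ‖w‖ ^ 2) / normSq (1 - w) := by
      have := congrArg Complex.re h2
      rw [Complex.div_ofReal_re] at this
      rw [Complex.sub_re, Complex.ofReal_re] at this
      rw [this, Complex.sq_norm, Complex.normSq_apply w]
      congr 1
      simp
      ring
    have h6 : 0 < (ρ.re - a) * (1 - ‖w‖ ^ 2) / normSq (1 - w) := by
      have : ‖w‖ ^ 2 < 1 := by
        have := norm_nonneg w
        nlinarith
      have h7 : 0 < 1 - ‖w‖ ^ 2 := by linarith
      have h8 : 0 < ρ.re - a := by linarith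
      positivity
    linarith
  have hGd : DifferentiableOn ℂ (F ∘ φ) (Metric.ball 0 1) := by
    refine hd.comp ?_ fun w hw => hre w (by simpa using hw)
    intro w hw
    refine DifferentiableAt.differentiableWithinAt ?_
    have := hne w (by simpa using hw)
    fun_prop (disch := assumption)
  have hG0 : (F ∘ φ) 0 = 0 := by simp [hφ, h0]
  have hpos := norm_add_conj_sub_pos hs hρ
  have hpos' : s + conj ρ - 2 * a ≠ 0 := norm_pos_iff.1 hpos
  set w : ℂ := (s - ρ) / (s + conj ρ - 2 * a) with hw
  have hwlt : ‖w‖ < 1 := by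
    rw [hw, norm_div, div_lt_one hpos]
    refine lt_of_pow_lt_pow_left₀ 2 hpos.le ?_
    rw [Complex.sq_norm, Complex.sq_norm, Complex.normSq_apply, Complex.normSq_apply]
    simp
    nlinarith [mul_pos (sub_pos.2 hs) (sub_pos.2 hρ)]
  have hφw : φ w = s := by
    have h1 := hne w hwlt
    simp only [hφ]
    rw [div_eq_iff h1, hw]
    field_simp
    ring
  have key := Complex.dist_le_div_mul_dist_of_mapsTo_ball (R₂ := M) hGd
    (fun z hz => by
      rw [hG0, mem_closedBall_zero_iff]
      exact hM _ (hre z (by simpa using hz))) (z := w) (by simpa using hwlt)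
  rw [hG0] at key
  simp only [Function.comp_apply, hφw, dist_zero_right, div_one] at key
  rw [hw, norm_div, mul_div_assoc', le_div_iff₀ hpos] at key
  exact key

open Complex ComplexConjugate in
/-- A bounded holomorphic function on a half-plane is small at points that are
hyperbolically close to many of its zeros. -/
theorem norm_le_mul_pow_card_of_zeros_halfPlane {a M e : ℝ} {c : ℂ} (hc : a < c.re) (he : 0 ≤ e)
    (S : Finset ℂ) (F : ℂ → ℂ) (hd : DifferentiableOn ℂ F {s | a < s.re})
    (hM : ∀ s : ℂ, a < s.re → ‖F s‖ ≤ M)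
    (hS : ∀ ρ ∈ S, a < ρ.re ∧ F ρ = 0 ∧ ‖c - ρ‖ ≤ e * ‖c + conj ρ - 2 * a‖) :
    ‖F c‖ ≤ M * e ^ S.card := by
  induction S using Finset.induction_on generalizing F with
  | empty => simpa using hM c hc
  | insert ρ S hρS ih =>
    obtain ⟨hρ, h0, hclose⟩ := hS ρ (Finset.mem_insert_self _ _)
    have hopen : IsOpen {s : ℂ | a < s.re} := isOpen_lt continuous_const Complex.continuous_re
    set G : ℂ → ℂ := fun s => dslope F ρ s * (s + conj ρ - 2 * a) with hG
    have hGd : DifferentiableOn ℂ G {s | a < s.re} :=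
      ((Complex.differentiableOn_dslope (hopen.mem_nhds hρ)).2 hd).mul (by fun_prop)
    have hFG : ∀ s, F s * (s + conj ρ - 2 * a) = (s - ρ) * G s := by
      intro s
      have := sub_smul_dslope F ρ s
      rw [h0, sub_zero, smul_eq_mul] at this
      rw [← this]
      ring
    have hGM' : ∀ s : ℂ, a < s.re → s ≠ ρ → ‖G s‖ ≤ M := by
      intro s hs hne
      have h1 := norm_mul_norm_le_of_eq_zero_of_halfPlane hd hM hρ h0 hs
      rw [← norm_mul, hFG, norm_mul, mul_comm] at h1
      exact le_of_mul_le_mul_right h1 (norm_pos_iff.2 (sub_ne_zero.2 hne))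
    have hGM : ∀ s : ℂ, a < s.re → ‖G s‖ ≤ M := by
      intro s hs
      by_cases hne : s = ρ
      · subst hne
        have hcont : ContinuousAt G s := (hGd.differentiableAt (hopen.mem_nhds hs)).continuousAt
        refine le_of_tendsto (hcont.norm.tendsto.mono_left (nhdsWithin_le_nhds (s := {s}ᶜ))) ?_
        filter_upwards [self_mem_nhdsWithin, nhdsWithin_le_nhds (hopen.mem_nhds hs)] with z hz hz'
        exact hGM' z hz' hz
      · exact hGM' s hs hne
    have hGS := ih G hGd hGM fun z hz => by
      obtain ⟨h1, h2, h3⟩ := hS z (Finset.mem_insert_of_mem hz)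
      refine ⟨h1, ?_, h3⟩
      have h4 := hFG z
      rw [h2, zero_mul] at h4
      refine (mul_eq_zero.1 h4.symm).resolve_left (sub_ne_zero.2 ?_)
      rintro rfl
      exact hρS hz
    have hpos := norm_add_conj_sub_pos hc hρ
    have h5 : ‖F c‖ * ‖c + conj ρ - 2 * a‖ = ‖c - ρ‖ * ‖G c‖ := by
      rw [← norm_mul, hFG, norm_mul]
    rw [Finset.card_insert_of_notMem hρS]
    refine le_of_mul_le_mul_right ?_ hpos
    calc ‖F c‖ * ‖c + conj ρ - 2 * a‖ = ‖c - ρ‖ * ‖G c‖ := h5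
      _ ≤ (e * ‖c + conj ρ - 2 * a‖) * (M * e ^ S.card) := by gcongr
      _ = M * e ^ (S.card + 1) * ‖c + conj ρ - 2 * a‖ := by ring

open Complex ComplexConjugate in
/-- A quantitative pseudo-hyperbolic distance bound between points near the line `re = a`. -/
theorem norm_sub_le_exp_mul_norm {a δ : ℝ} {c ρ : ℂ} (hδ : 0 < δ)
    (hu : 9 / 10 * δ ≤ ρ.re - a) (hP : ρ.re - a ≤ c.re - a - 1) (hP2 : c.re - a ≤ 2)
    (him : |ρ.im - c.im| ≤ 1) :
    ‖c - ρ‖ ≤ Real.exp (-(δ / 3.1)) * ‖c + conj ρ - 2 * a‖ := by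
  refine le_of_pow_le_pow_left₀ two_ne_zero (by positivity) ?_
  rw [mul_pow, ← Real.exp_nat_mul, Complex.sq_norm, Complex.sq_norm, Complex.normSq_apply,
    Complex.normSq_apply]
  have hy : (ρ.im - c.im) ^ 2 ≤ 1 := by rwa [sq_le_one_iff_abs_le_one]
  set u := ρ.re - a with hu'
  set P := c.re - a with hP'
  set y := ρ.im - c.im with hy'
  have h1 : (c - ρ).re * (c - ρ).re + (c - ρ).im * (c - ρ).im = (P - u) ^ 2 + y ^ 2 := by
    simp [hu', hP', hy']; ring
  have h2 : (c + conj ρ - 2 * a).re * (c + conj ρ - 2 * a).re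
      + (c + conj ρ - 2 * a).im * (c + conj ρ - 2 * a).im = (P + u) ^ 2 + y ^ 2 := by
    simp [hu', hP', hy']; ring
  rw [h1, h2]
  have hu0 : 0 < u := by linarith
  have h3 : 2 * (δ / 3.1) * ((P + u) ^ 2 + y ^ 2) ≤ 4 * u * P := by
    have h4 : (P + u) ^ 2 + y ^ 2 ≤ 5.58 * P := by nlinarith
    have h5 : 2 * (δ / 3.1) * ((P + u) ^ 2 + y ^ 2) ≤ 2 * (u / 2.79) * (5.58 * P) := by
      gcongr ?_ * ?_
      norm_num
      linarith
    refine h5.trans (le_of_eq ?_)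
    ring
  have h6 := Real.add_one_le_exp (((2 : ℕ) : ℝ) * -(δ / 3.1))
  have h7 : 0 ≤ (P + u) ^ 2 + y ^ 2 := by positivity
  push_cast at h6 ⊢
  nlinarith [mul_le_mul_of_nonneg_right h6 h7]

open Finset in
/-- Sieving out the first `n` generators from a completely multiplicative sum over the free
commutative monoid. -/
theorem prod_one_sub_mul_tsum_eq {𝕜 : Type*} [NormedField 𝕜] [CompleteSpace 𝕜]
    {F : (ℕ →₀ ℕ) → 𝕜} (hadd : ∀ g h, F (g + h) = F g * F h)
    (hF : Summable fun g => ‖F g‖) (n : ℕ) :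
    (∏ i ∈ range n, (1 - F (Finsupp.single i 1))) * ∑' g, F g
      = ∑' g, Set.indicator {g : ℕ →₀ ℕ | ∀ i < n, g i = 0} F g := by
  induction n with
  | zero => simp
  | succ n ih =>
    set e : ℕ →₀ ℕ := Finsupp.single n 1 with he
    have hF' : Summable F := hF.of_norm
    have h1 : F e * ∑' g, Set.indicator {g : ℕ →₀ ℕ | ∀ i < n, g i = 0} F g
        = ∑' g, Set.indicator {g : ℕ →₀ ℕ | (∀ i < n, g i = 0) ∧ g n ≠ 0} F g := by
      rw [← tsum_mul_left]
      have hinj : Function.Injective fun g : ℕ →₀ ℕ => g + e := add_left_injective e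
      refine Eq.trans (tsum_congr fun g => ?_) (hinj.tsum_eq ?_)
      · have hiff : g + e ∈ {g : ℕ →₀ ℕ | (∀ i < n, g i = 0) ∧ g n ≠ 0}
            ↔ g ∈ {g : ℕ →₀ ℕ | ∀ i < n, g i = 0} := by
          simp only [Set.mem_ofPred_eq, Finsupp.add_apply, he]
          constructor
          · rintro ⟨h, -⟩ i hi
            have := h i hi
            omega
          · intro h
            refine ⟨fun i hi => ?_, by simp⟩
            rw [h i hi, Finsupp.single_eq_of_ne hi.ne, add_zero]
        by_cases hg : g ∈ {g : ℕ →₀ ℕ | ∀ i < n, g i = 0}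
        · rw [Set.indicator_of_mem hg, Set.indicator_of_mem (hiff.2 hg), hadd, mul_comm]
        · rw [Set.indicator_of_notMem hg, Set.indicator_of_notMem (mt hiff.1 hg), mul_zero]
      · intro g hg
        have hg' := (Set.mem_of_indicator_ne_zero hg).2
        refine ⟨g - e, tsub_add_cancel_of_le ?_⟩
        rw [he, Finsupp.single_le_iff]
        omega
    rw [prod_range_succ, mul_right_comm, ih, mul_sub, mul_one, mul_comm _ (F e), h1,
      ← (hF'.indicator _).tsum_sub (hF'.indicator _)]
    refine tsum_congr fun g => ?_
    have hsucc : (∀ i < n + 1, g i = 0) ↔ (∀ i < n, g i = 0) ∧ g n = 0 :=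
      Nat.forall_lt_succ_right
    simp only [Set.indicator_apply, Set.mem_ofPred_eq, hsucc]
    split_ifs <;> first | (exfalso; tauto) | simp

/-- A completely multiplicative absolutely convergent sum is bounded below by the inverse of the
sum of its norms. -/
theorem one_le_tsum_norm_mul_norm_tsum {𝕜 : Type*} [NormedField 𝕜] [CompleteSpace 𝕜]
    {F : (ℕ →₀ ℕ) → 𝕜} (hadd : ∀ g h, F (g + h) = F g * F h) (hzero : F 0 = 1)
    (hF : Summable fun g => ‖F g‖) (hlt : ∀ i, ‖F (Finsupp.single i 1)‖ < 1) :
    1 ≤ (∑' g, ‖F g‖) * ‖∑' g, F g‖ := by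
  have hlim : Filter.Tendsto
      (fun n : ℕ => ∑' g, Set.indicator {g : ℕ →₀ ℕ | ∀ i < n, g i = 0} F g) Filter.atTop
      (nhds (∑' g : ℕ →₀ ℕ, if g = 0 then (1 : 𝕜) else 0)) := by
    have hle (n : ℕ) (g : ℕ →₀ ℕ) :
        ‖Set.indicator {g : ℕ →₀ ℕ | ∀ i < n, g i = 0} F g‖ ≤ ‖F g‖ := by
      rw [Set.indicator_apply]
      split_ifs <;> simp
    refine tendsto_tsum_of_dominated_convergence hF (fun g => ?_)
      (Filter.Eventually.of_forall hle)
    by_cases hg : g = 0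
    · subst hg
      simp [hzero]
    · obtain ⟨i, hi⟩ := Finsupp.ne_iff.1 hg
      refine tendsto_const_nhds.congr' ?_
      filter_upwards [Filter.eventually_gt_atTop i] with n hn
      rw [if_neg hg, Set.indicator_of_notMem]
      exact fun h => hi (h i hn)
  rw [tsum_ite_eq] at hlim
  have hnorm := hlim.norm
  rw [norm_one] at hnorm
  refine le_of_tendsto hnorm (Filter.Eventually.of_forall fun n => ?_)
  rw [← prod_one_sub_mul_tsum_eq hadd hF n, norm_mul, norm_prod]
  gcongr
  have hsieve := prod_one_sub_mul_tsum_eq (F := fun g => ‖F g‖) (fun g h => by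
    rw [hadd, norm_mul]) (by simpa using hF) n
  have hone : 1 ≤ ∑' g, Set.indicator {g : ℕ →₀ ℕ | ∀ i < n, g i = 0} (fun g => ‖F g‖) g := by
    have := (hF.indicator {g : ℕ →₀ ℕ | ∀ i < n, g i = 0}).le_tsum 0
      (fun g _ => Set.indicator_nonneg (fun _ _ => norm_nonneg _) g)
    simpa [hzero] using this
  rw [← hsieve] at hone
  calc ∏ i ∈ Finset.range n, ‖1 - F (Finsupp.single i 1)‖
      ≤ ∏ i ∈ Finset.range n, (1 + ‖F (Finsupp.single i 1)‖) :=
        Finset.prod_le_prod (fun _ _ => norm_nonneg _) fun i _ => by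
          simpa using norm_sub_le (1 : 𝕜) (F (Finsupp.single i 1))
    _ ≤ (∏ i ∈ Finset.range n, (1 + ‖F (Finsupp.single i 1)‖)) *
          ((∏ i ∈ Finset.range n, (1 - ‖F (Finsupp.single i 1)‖)) * ∑' g, ‖F g‖) :=
        le_mul_of_one_le_right (Finset.prod_nonneg fun _ _ => by positivity) hone
    _ = (∏ i ∈ Finset.range n, ((1 + ‖F (Finsupp.single i 1)‖) *
          (1 - ‖F (Finsupp.single i 1)‖))) * ∑' g, ‖F g‖ := by
        rw [Finset.prod_mul_distrib, mul_assoc]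
    _ ≤ 1 * ∑' g, ‖F g‖ := by
        refine mul_le_mul_of_nonneg_right ?_ (tsum_nonneg fun _ => norm_nonneg _)
        refine Finset.prod_le_one (fun i _ => ?_) fun i _ => ?_
        · have := hlt i
          have := norm_nonneg (F (Finsupp.single i 1))
          nlinarith
        · nlinarith [sq_nonneg ‖F (Finsupp.single i 1)‖]
    _ = ∑' g, ‖F g‖ := one_mul _

theorem one_le_bNorm {q : ℕ → ℝ} (hq : ∀ i, 1 < q i) (g : ℕ →₀ ℕ) : 1 ≤ bNorm q g :=
  Finset.prod_induction _ (fun x : ℝ => 1 ≤ x) (fun _ _ => one_le_mul_of_one_le_of_one_le) le_rfl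
    fun i _ => one_le_pow₀ (hq i).le

theorem bNorm_pos {q : ℕ → ℝ} (hq : ∀ i, 1 < q i) (g : ℕ →₀ ℕ) : 0 < bNorm q g :=
  one_pos.trans_le (one_le_bNorm hq g)

theorem bNorm_zero (q : ℕ → ℝ) : bNorm q 0 = 1 := Finsupp.prod_zero_index

theorem bNorm_add (q : ℕ → ℝ) (g h : ℕ →₀ ℕ) : bNorm q (g + h) = bNorm q g * bNorm q h :=
  Finsupp.prod_add_index' (fun _ => pow_zero _) fun _ _ _ => pow_add _ _ _

theorem bNorm_single (q : ℕ → ℝ) (i : ℕ) : bNorm q (Finsupp.single i 1) = q i := by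
  simp [bNorm]

theorem monotone_bN {q : ℕ → ℝ} (hfin : ∀ x : ℝ, {g : ℕ →₀ ℕ | bNorm q g ≤ x}.Finite) :
    Monotone fun x => (bN q x : ℝ) := fun _ y hxy =>
  Nat.cast_le.2 (Set.ncard_le_ncard (fun _ hg => le_trans hg hxy) (hfin y))

theorem measurable_bR {q : ℕ → ℝ} (hfin : ∀ x : ℝ, {g : ℕ →₀ ℕ | bNorm q g ≤ x}.Finite) (κ : ℝ) :
    Measurable (bR q κ) :=
  (monotone_bN hfin).measurable.sub (by fun_prop)

theorem norm_bR_mul_cpow_le {q : ℕ → ℝ} {κ A θ : ℝ}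
    (hAxiomA : ∀ x : ℝ, 1 ≤ x → |bR q κ x| ≤ A * x ^ θ) (s : ℂ) {x : ℝ} (hx : 1 < x) :
    ‖(bR q κ x : ℂ) * (x : ℂ) ^ (-s - 1)‖ ≤ A * x ^ (θ - s.re - 1) := by
  have hx0 : 0 < x := one_pos.trans hx
  rw [norm_mul, Complex.norm_real, Real.norm_eq_abs, Complex.norm_cpow_eq_rpow_re_of_pos hx0]
  refine (mul_le_mul_of_nonneg_right (hAxiomA x hx.le) (by positivity)).trans_eq ?_
  rw [mul_assoc, ← Real.rpow_add hx0]
  simp only [Complex.sub_re, Complex.neg_re, Complex.one_re]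
  ring_nf

theorem integrableOn_bR_mul_cpow {q : ℕ → ℝ}
    (hfin : ∀ x : ℝ, {g : ℕ →₀ ℕ | bNorm q g ≤ x}.Finite) {κ A θ : ℝ}
    (hAxiomA : ∀ x : ℝ, 1 ≤ x → |bR q κ x| ≤ A * x ^ θ) {s : ℂ} (hs : θ < s.re) :
    MeasureTheory.IntegrableOn (fun x : ℝ => (bR q κ x : ℂ) * (x : ℂ) ^ (-s - 1))
      (Set.Ioi 1) := by
  refine MeasureTheory.Integrable.mono'
    ((integrableOn_Ioi_rpow_of_lt (a := θ - s.re - 1) (by linarith) one_pos).const_mul A)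
    ((Complex.measurable_ofReal.comp (measurable_bR hfin κ)).mul
      (by fun_prop)).aestronglyMeasurable ?_
  filter_upwards [MeasureTheory.ae_restrict_mem measurableSet_Ioi] with x hx
  exact norm_bR_mul_cpow_le hAxiomA s hx

theorem norm_integral_bR_mul_cpow_le {q : ℕ → ℝ} {κ A θ : ℝ}
    (hAxiomA : ∀ x : ℝ, 1 ≤ x → |bR q κ x| ≤ A * x ^ θ) {s : ℂ} (hs : θ < s.re) :
    ‖∫ x in Set.Ioi (1 : ℝ), (bR q κ x : ℂ) * (x : ℂ) ^ (-s - 1)‖ ≤ A / (s.re - θ) := by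
  refine (MeasureTheory.norm_integral_le_of_norm_le
    ((integrableOn_Ioi_rpow_of_lt (a := θ - s.re - 1) (by linarith) one_pos).const_mul A)
    ?_).trans_eq ?_
  · filter_upwards [MeasureTheory.ae_restrict_mem measurableSet_Ioi] with x hx
    exact norm_bR_mul_cpow_le hAxiomA s hx
  · rw [MeasureTheory.integral_const_mul, integral_Ioi_rpow_of_lt (by linarith) one_pos,
      Real.one_rpow, show θ - s.re - 1 + 1 = -(s.re - θ) by ring, neg_div_neg_eq, mul_one_div]

theorem differentiableOn_integral_bR_mul_cpow {q : ℕ → ℝ}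
    (hfin : ∀ x : ℝ, {g : ℕ →₀ ℕ | bNorm q g ≤ x}.Finite) {κ A θ : ℝ} (hA : 0 ≤ A) (hθ : 0 ≤ θ)
    (hAxiomA : ∀ x : ℝ, 1 ≤ x → |bR q κ x| ≤ A * x ^ θ) :
    DifferentiableOn ℂ
      (fun s : ℂ => ∫ x in Set.Ioi (1 : ℝ), (bR q κ x : ℂ) * (x : ℂ) ^ (-s - 1))
      {s | θ < s.re} := by
  set f : ℝ → ℂ := (Set.Ioi (1 : ℝ)).indicator fun x => (bR q κ x : ℂ) with hf
  have hmellin : (fun s : ℂ => ∫ x in Set.Ioi (1 : ℝ), (bR q κ x : ℂ) * (x : ℂ) ^ (-s - 1))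
      = fun s => mellin f (-s) := by
    funext s
    have hind : ∀ x : ℝ, (x : ℂ) ^ (-s - 1) • f x
        = (Set.Ioi (1 : ℝ)).indicator (fun x => (bR q κ x : ℂ) * (x : ℂ) ^ (-s - 1)) x := by
      intro x
      by_cases hx : x ∈ Set.Ioi (1 : ℝ)
      · rw [hf, Set.indicator_of_mem hx, Set.indicator_of_mem hx, smul_eq_mul, mul_comm]
      · rw [hf, Set.indicator_of_notMem hx, Set.indicator_of_notMem hx, smul_zero]
    simp only [mellin, hind]
    rw [MeasureTheory.setIntegral_indicator measurableSet_Ioi, Set.Ioi_inter_Ioi]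
    simp
  rw [hmellin]
  have hmeas : Measurable f :=
    (Complex.measurable_ofReal.comp (measurable_bR hfin κ)).indicator measurableSet_Ioi
  have hbound : ∀ x, ‖f x‖ ≤ ‖A * |x| ^ θ‖ := by
    intro x
    rw [Real.norm_of_nonneg (by positivity)]
    by_cases hx : x ∈ Set.Ioi (1 : ℝ)
    · rw [hf, Set.indicator_of_mem hx, Complex.norm_real, Real.norm_eq_abs,
        abs_of_pos (show (0 : ℝ) < x from one_pos.trans hx)]
      exact hAxiomA x (le_of_lt hx)
    · rw [hf, Set.indicator_of_notMem hx, norm_zero]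
      positivity
  have hcont : Continuous fun x : ℝ => A * |x| ^ θ :=
    continuous_const.mul (continuous_abs.rpow_const fun _ => Or.inr hθ)
  have hloc : MeasureTheory.LocallyIntegrable f :=
    hcont.locallyIntegrable.mono hmeas.aestronglyMeasurable (Filter.Eventually.of_forall hbound)
  have hbot : f =ᶠ[nhdsWithin 0 (Set.Ioi 0)] fun _ => 0 := by
    filter_upwards [nhdsWithin_le_nhds (Iio_mem_nhds one_pos)] with x hx
    exact Set.indicator_of_notMem (fun h => lt_asymm hx h) _
  intro s hs
  refine DifferentiableAt.differentiableWithinAt ?_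
  refine DifferentiableAt.comp s (g := mellin f) (f := fun s => -s) ?_ (by fun_prop)
  refine mellin_differentiableAt_of_isBigO_rpow (a := -θ) (b := -s.re - 1)
    (hloc.locallyIntegrableOn _) ?_ (by simpa using hs) ?_ (by simp)
  · refine Asymptotics.IsBigO.of_bound A ?_
    filter_upwards [Filter.eventually_gt_atTop 0] with x hx
    refine (hbound x).trans_eq ?_
    rw [Real.norm_of_nonneg (by positivity), Real.norm_of_nonneg (by positivity), abs_of_pos hx,
      neg_neg]
  · exact hbot.trans_isBigO (Asymptotics.isBigO_zero _ _)

theorem integrableOn_bN_mul_cpow_and_bZeta_eq {q : ℕ → ℝ}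
    (hfin : ∀ x : ℝ, {g : ℕ →₀ ℕ | bNorm q g ≤ x}.Finite) {κ A θ : ℝ} (hθ : θ < 1)
    (hAxiomA : ∀ x : ℝ, 1 ≤ x → |bR q κ x| ≤ A * x ^ θ) {s : ℂ} (hs : 1 < s.re) :
    MeasureTheory.IntegrableOn (fun x : ℝ => (bN q x : ℂ) * (x : ℂ) ^ (-s - 1)) (Set.Ioi 1) ∧
      bZeta q κ s = s * ∫ x in Set.Ioi (1 : ℝ), (bN q x : ℂ) * (x : ℂ) ^ (-s - 1) := by
  have hR := integrableOn_bR_mul_cpow hfin hAxiomA (hθ.trans hs)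
  have h1 : MeasureTheory.IntegrableOn (fun x : ℝ => (x : ℂ) ^ (-s)) (Set.Ioi 1) :=
    integrableOn_Ioi_cpow_of_lt (by simpa using hs) one_pos
  have h2 : MeasureTheory.IntegrableOn (fun x : ℝ => (x : ℂ) ^ (-s - 1)) (Set.Ioi 1) :=
    integrableOn_Ioi_cpow_of_lt (by simp; linarith) one_pos
  have hK : MeasureTheory.IntegrableOn
      (fun x : ℝ => (κ : ℂ) * ((x : ℂ) ^ (-s) - (x : ℂ) ^ (-s - 1))) (Set.Ioi 1) :=
    (h1.sub h2).const_mul _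
  have heq : Set.EqOn (fun x : ℝ => (bN q x : ℂ) * (x : ℂ) ^ (-s - 1))
      (fun x : ℝ => (bR q κ x : ℂ) * (x : ℂ) ^ (-s - 1)
        + (κ : ℂ) * ((x : ℂ) ^ (-s) - (x : ℂ) ^ (-s - 1))) (Set.Ioi 1) := by
    intro x hx
    have hx0 : (x : ℂ) ≠ 0 := by
      exact_mod_cast (one_pos.trans (show (1 : ℝ) < x from hx)).ne'
    have h3 : (x : ℂ) ^ (-s) = x * (x : ℂ) ^ (-s - 1) := by
      rw [Complex.cpow_sub _ _ hx0, Complex.cpow_one]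
      field_simp
    simp only [bR, h3]
    push_cast
    ring
  refine ⟨(hR.add hK).congr_fun heq.symm measurableSet_Ioi, ?_⟩
  have hs0 : s ≠ 0 := by
    rintro rfl
    simp at hs
    linarith
  have hs1 : s - 1 ≠ 0 := by
    intro h
    rw [sub_eq_zero.1 h] at hs
    simp at hs
  have hs1' : -s + 1 ≠ 0 := by
    intro h
    exact hs1 (by linear_combination -h)
  rw [MeasureTheory.setIntegral_congr_fun measurableSet_Ioi heq,
    MeasureTheory.integral_add hR hK, MeasureTheory.integral_const_mul,
    MeasureTheory.integral_sub h1 h2, integral_Ioi_cpow_of_lt (by simpa using hs) one_pos,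
    integral_Ioi_cpow_of_lt (by simp; linarith) one_pos]
  simp only [bZeta, Complex.ofReal_one, Complex.one_cpow, sub_add_cancel]
  rw [show -1 / (-s + 1) = 1 / (s - 1) by rw [← neg_div_neg_eq]; congr 1 <;> ring,
    show -1 / -s = 1 / s by rw [neg_div_neg_eq]]
  field_simp
  ring

theorem integral_ite_bNorm_le {n : ℝ} (hn : 1 ≤ n) {s : ℂ} (hs : 0 < s.re) :
    ∫ x in Set.Ioi (1 : ℝ), (if n ≤ x then (x : ℂ) ^ (-s - 1) else 0) = (n : ℂ) ^ (-s) / s := by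
  have h1 : (fun x : ℝ => if n ≤ x then (x : ℂ) ^ (-s - 1) else 0)
      = (Set.Ici n).indicator fun x : ℝ => (x : ℂ) ^ (-s - 1) := by
    funext x
    simp [Set.indicator_apply]
  have h2 : (Set.Ioi 1 ∩ Set.Ici n : Set ℝ) =ᵐ[MeasureTheory.volume] Set.Ioi n := by
    have := (Filter.EventuallyEq.refl (MeasureTheory.ae MeasureTheory.volume)
      (Set.Ioi (1 : ℝ))).inter (MeasureTheory.Ioi_ae_eq_Ici (a := n)
        (μ := MeasureTheory.volume)).symm
    rwa [Set.Ioi_inter_Ioi, max_eq_right hn] at this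
  rw [h1, MeasureTheory.setIntegral_indicator measurableSet_Ici,
    MeasureTheory.setIntegral_congr_set h2,
    integral_Ioi_cpow_of_lt (by simp; linarith) (one_pos.trans_le hn), sub_add_cancel,
    neg_div_neg_eq]

/-- The Dirichlet series of the Beurling zeta function. -/
theorem summable_norm_and_hasSum_bZeta {q : ℕ → ℝ} (hq : ∀ i, 1 < q i)
    (hfin : ∀ x : ℝ, {g : ℕ →₀ ℕ | bNorm q g ≤ x}.Finite) {κ A θ : ℝ} (hθ : θ < 1)
    (hAxiomA : ∀ x : ℝ, 1 ≤ x → |bR q κ x| ≤ A * x ^ θ) {s : ℂ} (hs : 1 < s.re) :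
    (Summable fun g => ‖(bNorm q g : ℂ) ^ (-s)‖) ∧
      HasSum (fun g => (bNorm q g : ℂ) ^ (-s)) (bZeta q κ s) := by
  obtain ⟨hN, hζ⟩ := integrableOn_bN_mul_cpow_and_bZeta_eq hfin hθ hAxiomA hs
  have hs0' : 0 < s.re := one_pos.trans hs
  have hs0 : s ≠ 0 := by
    rintro rfl
    simp at hs0'
  set F : (ℕ →₀ ℕ) → ℝ → ℂ := fun g x => if bNorm q g ≤ x then (x : ℂ) ^ (-s - 1) else 0 with hF
  have hFint : ∀ g, MeasureTheory.Integrable (F g)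
      (MeasureTheory.volume.restrict (Set.Ioi 1)) := by
    intro g
    have h2 : MeasureTheory.IntegrableOn (fun x : ℝ => (x : ℂ) ^ (-s - 1)) (Set.Ioi 1) :=
      integrableOn_Ioi_cpow_of_lt (by simp; linarith) one_pos
    have : F g = (Set.Ici (bNorm q g)).indicator fun x : ℝ => (x : ℂ) ^ (-s - 1) := by
      funext x
      simp [hF, Set.indicator_apply]
    rw [this]
    exact h2.indicator measurableSet_Ici
  have hFval : ∀ g, ∫ x in Set.Ioi (1 : ℝ), F g x = (bNorm q g : ℂ) ^ (-s) / s := fun g =>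
    integral_ite_bNorm_le (one_le_bNorm hq g) hs0'
  have hFsum : Summable fun g => ∫ x in Set.Ioi (1 : ℝ), ‖F g x‖ := by
    refine summable_of_sum_le (c := ∫ x in Set.Ioi (1 : ℝ), ‖(bN q x : ℂ) * (x : ℂ) ^ (-s - 1)‖)
      (fun g => MeasureTheory.integral_nonneg fun x => norm_nonneg _) fun u => ?_
    rw [← MeasureTheory.integral_finsetSum _ fun g _ => (hFint g).norm]
    refine MeasureTheory.integral_mono
      (MeasureTheory.integrable_finsetSum _ fun g _ => (hFint g).norm) hN.norm fun x => ?_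
    have hcard : (u.filter fun g => bNorm q g ≤ x).card ≤ bN q x := by
      rw [← Set.ncard_coe_finset]
      exact Set.ncard_le_ncard (fun g hg => by simpa using (Finset.mem_filter.1 hg).2) (hfin x)
    simp only [hF, apply_ite norm, norm_zero, norm_mul, Complex.norm_natCast]
    rw [← Finset.sum_filter, Finset.sum_const, nsmul_eq_mul]
    gcongr
  have hsum := MeasureTheory.hasSum_integral_of_summable_integral_norm hFint hFsum
  have htsum : ∀ x : ℝ, ∑' g, F g x = (bN q x : ℂ) * (x : ℂ) ^ (-s - 1) := by
    intro x
    rw [tsum_eq_sum (s := (hfin x).toFinset) fun g hg => if_neg (by simpa using hg),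
      Finset.sum_congr rfl fun g hg => if_pos (by simpa using hg), Finset.sum_const,
      nsmul_eq_mul, bN, Set.ncard_eq_toFinset_card _ (hfin x)]
  simp only [htsum, hFval] at hsum
  have hsum' := hsum.mul_left s
  simp only [mul_div_cancel₀ _ hs0, ← hζ] at hsum'
  refine ⟨?_, hsum'⟩
  refine (hFsum.mul_left ‖s‖).of_nonneg_of_le (fun _ => norm_nonneg _) fun g => ?_
  calc ‖(bNorm q g : ℂ) ^ (-s)‖ = ‖s‖ * ‖∫ x in Set.Ioi (1 : ℝ), F g x‖ := by
        rw [hFval, ← norm_mul, mul_div_cancel₀ _ hs0]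
    _ ≤ _ := by
        gcongr
        exact MeasureTheory.norm_integral_le_integral_norm _

/-- A lower bound for the Beurling zeta function to the right of `re = 1`, from its Euler
product. -/
theorem one_le_norm_bZeta_mul_norm_bZeta {q : ℕ → ℝ} (hq : ∀ i, 1 < q i)
    (hfin : ∀ x : ℝ, {g : ℕ →₀ ℕ | bNorm q g ≤ x}.Finite) {κ A θ : ℝ} (hθ : θ < 1)
    (hAxiomA : ∀ x : ℝ, 1 ≤ x → |bR q κ x| ≤ A * x ^ θ) {s : ℂ} (hs : 1 < s.re) :
    1 ≤ ‖bZeta q κ s.re‖ * ‖bZeta q κ s‖ := by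
  obtain ⟨hsum, hζ⟩ := summable_norm_and_hasSum_bZeta hq hfin hθ hAxiomA hs
  obtain ⟨-, hζre⟩ := summable_norm_and_hasSum_bZeta hq hfin hθ hAxiomA
    (s := (s.re : ℂ)) (by simpa using hs)
  have hnorm : ((∑' g, ‖(bNorm q g : ℂ) ^ (-s)‖ : ℝ) : ℂ) = bZeta q κ s.re := by
    rw [Complex.ofReal_tsum, ← hζre.tsum_eq]
    refine tsum_congr fun g => ?_
    rw [Complex.norm_cpow_eq_rpow_re_of_pos (bNorm_pos hq g),
      Complex.ofReal_cpow (bNorm_pos hq g).le]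
    simp
  rw [← hnorm, ← hζ.tsum_eq, Complex.norm_real,
    Real.norm_of_nonneg (tsum_nonneg fun _ => norm_nonneg _)]
  refine one_le_tsum_norm_mul_norm_tsum (fun g h => ?_) ?_ hsum fun i => ?_
  · rw [bNorm_add, Complex.ofReal_mul,
      Complex.mul_cpow_ofReal_nonneg (bNorm_pos hq g).le (bNorm_pos hq h).le]
  · simp [bNorm_zero]
  · rw [bNorm_single, Complex.norm_cpow_eq_rpow_re_of_pos (one_pos.trans (hq i))]
    exact Real.rpow_lt_one_of_one_lt_of_neg (hq i) (by simp; linarith)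

theorem norm_bZeta_two_le {q : ℕ → ℝ} {κ A θ : ℝ} (hκ : 0 ≤ κ) (hA : 0 ≤ A) (hθ : θ < 1)
    (hAxiomA : ∀ x : ℝ, 1 ≤ x → |bR q κ x| ≤ A * x ^ θ) :
    ‖bZeta q κ 2‖ ≤ 2 * (A + κ) := by
  have hI := norm_integral_bR_mul_cpow_le hAxiomA (s := 2) (by simp; linarith)
  have hre : (2 : ℂ).re = 2 := by simp
  rw [hre] at hI
  have hI' : A / (2 - θ) ≤ A := div_le_self hA (by linarith)
  rw [bZeta]
  refine (norm_add_le _ _).trans ?_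
  rw [norm_mul, norm_div, Complex.norm_real, Real.norm_of_nonneg hκ,
    show (2 : ℂ) - 1 = 1 by norm_num, norm_one, div_one, Complex.norm_two]
  calc _ ≤ κ + 2 * A := by gcongr; exact hI.trans hI'
    _ ≤ 2 * (A + κ) := by linarith

/-- The function `(s - 1) ζ(s) / (s + 1) ^ 2`, holomorphic for `θ < re s` and bounded on smaller
half-planes. -/
noncomputable def bZetaNormalized (q : ℕ → ℝ) (κ : ℝ) (s : ℂ) : ℂ :=
  ((κ : ℂ) + s * (s - 1) * ∫ x in Set.Ioi (1 : ℝ), (bR q κ x : ℂ) * (x : ℂ) ^ (-s - 1)) /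
    (s + 1) ^ 2

theorem bZetaNormalized_eq (q : ℕ → ℝ) (κ : ℝ) {s : ℂ} (hs : s ≠ 1) :
    bZetaNormalized q κ s = (s - 1) * bZeta q κ s / (s + 1) ^ 2 := by
  have : s - 1 ≠ 0 := sub_ne_zero.2 hs
  rw [bZetaNormalized, bZeta, mul_add, mul_div_cancel₀ _ this]
  ring

theorem differentiableOn_bZetaNormalized {q : ℕ → ℝ}
    (hfin : ∀ x : ℝ, {g : ℕ →₀ ℕ | bNorm q g ≤ x}.Finite) {κ A θ : ℝ} (hA : 0 ≤ A) (hθ : 0 ≤ θ)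
    (hAxiomA : ∀ x : ℝ, 1 ≤ x → |bR q κ x| ≤ A * x ^ θ) :
    DifferentiableOn ℂ (bZetaNormalized q κ) {s | θ < s.re} := by
  have hI := differentiableOn_integral_bR_mul_cpow hfin hA hθ hAxiomA
  refine DifferentiableOn.div (.add (by fun_prop) (.mul (by fun_prop) hI)) (by fun_prop) ?_
  intro s hs h
  have h1 : s + 1 = 0 := by simpa using h
  have := congrArg Complex.re h1
  simp at this
  have : θ < s.re := hs
  linarith

theorem norm_bZetaNormalized_le {q : ℕ → ℝ} {κ A θ a : ℝ} (hκ : 0 ≤ κ) (hA : 0 ≤ A) (hθ : 0 ≤ θ)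
    (hAxiomA : ∀ x : ℝ, 1 ≤ x → |bR q κ x| ≤ A * x ^ θ) (ha : θ < a) {s : ℂ} (hs : a < s.re) :
    ‖bZetaNormalized q κ s‖ ≤ κ + A / (a - θ) := by
  have hre : 0 < s.re := hθ.trans_lt (ha.trans hs)
  have h0 : 0 < a - θ := sub_pos.2 ha
  have hone : 1 ≤ ‖s + 1‖ := by
    refine le_trans ?_ (Complex.re_le_norm _)
    simp
    linarith
  have hle : ∀ {z : ℂ}, Complex.normSq z ≤ Complex.normSq (s + 1) → ‖z‖ ≤ ‖s + 1‖ := by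
    intro z hz
    refine le_of_pow_le_pow_left₀ two_ne_zero (norm_nonneg _) ?_
    rwa [Complex.sq_norm, Complex.sq_norm]
  have hs1 : ‖s - 1‖ ≤ ‖s + 1‖ := hle (by
    simp only [Complex.normSq_apply, Complex.sub_re, Complex.add_re, Complex.sub_im,
      Complex.add_im, Complex.one_re, Complex.one_im]
    nlinarith)
  have hs2 : ‖s‖ ≤ ‖s + 1‖ := hle (by
    simp only [Complex.normSq_apply, Complex.add_re, Complex.add_im, Complex.one_re,
      Complex.one_im]
    nlinarith)
  have hI : ‖∫ x in Set.Ioi (1 : ℝ), (bR q κ x : ℂ) * (x : ℂ) ^ (-s - 1)‖ ≤ A / (a - θ) :=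
    (norm_integral_bR_mul_cpow_le hAxiomA (ha.trans hs)).trans (by gcongr)
  rw [bZetaNormalized, norm_div, norm_pow, div_le_iff₀ (by positivity), add_mul]
  refine (norm_add_le _ _).trans (add_le_add ?_ ?_)
  · rw [Complex.norm_real, Real.norm_of_nonneg hκ]
    exact le_mul_of_one_le_right hκ (one_le_pow₀ hone)
  · rw [norm_mul, norm_mul, mul_comm (A / (a - θ)), sq]
    gcongr

/-- The zeros of the Beurling zeta function near a given height. -/
theorem card_zeros_near_height_le {q : ℕ → ℝ} (hq : ∀ i, 1 < q i)
    (hfin : ∀ x : ℝ, {g : ℕ →₀ ℕ | bNorm q g ≤ x}.Finite)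
    {κ A θ b t : ℝ} (hκ : 0 < κ) (hA : 0 < A) (hθ0 : 0 < θ) (hθ1 : θ < 1)
    (hAxiomA : ∀ x : ℝ, 1 ≤ x → |bR q κ x| ≤ A * x ^ θ)
    (hAκ : 1 ≤ A + κ) (hb : θ < b) (hb1 : b < 1) (ht : 6 ≤ |t|) (S : Finset ℂ)
    (hS : ∀ ρ ∈ S, ρ ≠ 1 ∧ b ≤ ρ.re ∧ |ρ.im - t| ≤ 1 ∧ bZeta q κ ρ = 0) :
    (S.card : ℝ) ≤
      1 / (b - θ) * (3.1 * Real.log |t| + 3.1 * Real.log ((A + κ) ^ 2 / (b - θ)) + 12) := by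
  set δ := b - θ with hδ
  have hδ0 : 0 < δ := sub_pos.2 hb
  have hδ1 : δ < 1 := by linarith
  set a := θ + δ / 10 with ha
  have haθ : θ < a := by linarith
  set c : ℂ := ⟨2, t⟩ with hc
  have hcre : c.re = 2 := rfl
  have hcim : c.im = t := rfl
  have ht0 : 0 < |t| := by linarith
  have hre : ∀ ρ ∈ S, ρ.re ≤ 1 := by
    intro ρ hρ
    by_contra! h
    have := one_le_norm_bZeta_mul_norm_bZeta hq hfin hθ1 hAxiomA h
    rw [(hS ρ hρ).2.2.2, norm_zero, mul_zero] at this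
    exact absurd this (by norm_num)
  have hupper : ‖bZetaNormalized q κ c‖ ≤
      (κ + A / (a - θ)) * Real.exp (-(δ / 3.1)) ^ S.card := by
    refine norm_le_mul_pow_card_of_zeros_halfPlane (a := a) (by rw [hcre]; linarith)
      (Real.exp_pos _).le S _
      ((differentiableOn_bZetaNormalized hfin hA.le hθ0.le hAxiomA).mono
        fun s hs => haθ.trans hs)
      (fun s hs => norm_bZetaNormalized_le hκ.le hA.le hθ0.le hAxiomA haθ hs) fun ρ hρ => ?_
    obtain ⟨h1, h2, h3, h4⟩ := hS ρ hρ
    refine ⟨by linarith, ?_, ?_⟩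
    · rw [bZetaNormalized_eq q κ h1, h4, mul_zero, zero_div]
    · refine norm_sub_le_exp_mul_norm hδ0 (by linarith) ?_ (by rw [hcre]; linarith)
        (by rwa [hcim])
      rw [hcre]
      linarith [hre ρ hρ]
  have hM : κ + A / (a - θ) ≤ (A + κ) * 10 / δ := by
    rw [show a - θ = δ / 10 by rw [ha]; ring, div_div_eq_mul_div, add_mul, add_div,
      add_comm]
    gcongr
    rw [le_div_iff₀ hδ0]
    nlinarith
  have hzeta : 1 ≤ 2 * (A + κ) * ‖bZeta q κ c‖ := by
    refine (one_le_norm_bZeta_mul_norm_bZeta hq hfin hθ1 hAxiomA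
      (s := c) (by rw [hcre]; norm_num)).trans ?_
    rw [hcre]
    gcongr
    exact_mod_cast norm_bZeta_two_le hκ.le hA.le hθ1 hAxiomA
  have hc1 : c ≠ 1 := by
    intro h
    have := congrArg Complex.re h
    rw [hcre] at this
    norm_num at this
  have hlower : ‖bZeta q κ c‖ ≤ 5 / 4 * |t| * ‖bZetaNormalized q κ c‖ := by
    have h1 : |t| ≤ ‖c - 1‖ := by
      have := Complex.abs_im_le_norm (c - 1)
      simpa [hcim] using this
    have h2 : ‖c + 1‖ ^ 2 = 9 + |t| ^ 2 := by
      rw [Complex.sq_norm, Complex.normSq_apply, sq_abs]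
      simp [hcre, hcim]
      ring
    rw [bZetaNormalized_eq q κ hc1, norm_div, norm_mul, norm_pow, h2, mul_div_assoc',
      le_div_iff₀ (by positivity)]
    have h3 : 9 + |t| ^ 2 ≤ 5 / 4 * |t| * ‖c - 1‖ := by nlinarith
    calc ‖bZeta q κ c‖ * (9 + |t| ^ 2) ≤ ‖bZeta q κ c‖ * (5 / 4 * |t| * ‖c - 1‖) := by gcongr
      _ = _ := by ring
  have hmain : 1 ≤ 25 * |t| * ((A + κ) ^ 2 / δ) * Real.exp (-(δ / 3.1)) ^ S.card := by
    calc 1 ≤ 2 * (A + κ) * ‖bZeta q κ c‖ := hzeta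
      _ ≤ 2 * (A + κ) * (5 / 4 * |t| *
            ((A + κ) * 10 / δ * Real.exp (-(δ / 3.1)) ^ S.card)) := by
          gcongr
          refine hlower.trans ?_
          gcongr
          exact hupper.trans (by gcongr)
      _ = _ := by ring
  have hAκ0 : 0 < A + κ := by linarith
  have hlog := Real.log_le_log one_pos hmain
  rw [Real.log_one, Real.log_mul (by positivity) (by positivity),
    Real.log_mul (by positivity) (by positivity), Real.log_mul (by norm_num) ht0.ne',
    Real.log_pow, Real.log_exp] at hlog
  have h25 : Real.log 25 ≤ 12 / 3.1 := by
    calc Real.log 25 ≤ Real.log (2 ^ 5) := Real.log_le_log (by norm_num) (by norm_num)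
      _ = 5 * Real.log 2 := by rw [Real.log_pow]; norm_num
      _ ≤ 12 / 3.1 := by linarith [Real.log_two_lt_d9]
  rw [one_div, inv_mul_eq_div, le_div_iff₀ hδ0]
  have h4 : (S.card : ℝ) * -(δ / 3.1) = -(S.card * δ / 3.1) := by ring
  rw [h4] at hlog
  have h5 : (S.card : ℝ) * δ / 3.1 * 3.1 = S.card * δ := by ring
  linarith

/-- A set whose finite subsets have bounded cardinality is finite, with the same bound. -/
theorem finite_and_ncard_le_of_forall_finset {α : Type*} {s : Set α} {B : ℝ}
    (h : ∀ S : Finset α, (S : Set α) ⊆ s → (S.card : ℝ) ≤ B) :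
    s.Finite ∧ (s.ncard : ℝ) ≤ B := by
  have hfin : s.Finite := by
    by_contra hinf
    obtain ⟨n, hn⟩ := exists_nat_gt B
    obtain ⟨S, hS, hcard⟩ := Set.Infinite.exists_subset_card_eq hinf n
    have := h S hS
    rw [hcard] at this
    linarith
  refine ⟨hfin, ?_⟩
  rw [Set.ncard_eq_toFinset_card s hfin]
  exact h _ (by simp)

theorem statement_15
    (q : ℕ → ℝ) (hq : ∀ i, 1 < q i)
    (hfin : ∀ x : ℝ, {g : ℕ →₀ ℕ | bNorm q g ≤ x}.Finite)
    (κ A θ : ℝ) (hκ : 0 < κ) (hA : 0 < A) (hθ0 : 0 < θ) (hθ1 : θ < 1)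
    (hAxiomA : ∀ x : ℝ, 1 ≤ x → |bR q κ x| ≤ A * x ^ θ)
    (hAκ : 1 ≤ A + κ) (b T : ℝ) (hb : θ < b) (hb1 : b < 1) (hT : 6 ≤ T) :
    {ρ : ℂ | ρ ≠ 1 ∧ b ≤ ρ.re ∧ T - 1 ≤ |ρ.im| ∧ |ρ.im| ≤ T + 1 ∧ bZeta q κ ρ = 0}.Finite ∧
    ({ρ : ℂ | ρ ≠ 1 ∧ b ≤ ρ.re ∧ T - 1 ≤ |ρ.im| ∧ |ρ.im| ≤ T + 1 ∧
        bZeta q κ ρ = 0}.ncard : ℝ) ≤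
      1 / (b - θ) * (6.2 * Real.log T + 6.2 * Real.log ((A + κ) ^ 2 / (b - θ)) + 24) := by
  refine finite_and_ncard_le_of_forall_finset fun S hS => ?_
  have hcard : (S.card : ℝ) ≤ (S.filter fun ρ => 0 ≤ ρ.im).card
      + (S.filter fun ρ => ¬0 ≤ ρ.im).card := by
    exact_mod_cast (Finset.card_filter_add_card_filter_not (s := S) fun ρ : ℂ => 0 ≤ ρ.im).ge
  have habs : |T| = T := abs_of_pos (by linarith)
  have hup := card_zeros_near_height_le hq hfin hκ hA hθ0 hθ1 hAxiomA hAκ hb hb1 (t := T)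
    (by rwa [habs]) (S.filter fun ρ => 0 ≤ ρ.im) fun ρ hρ => by
      obtain ⟨hρS, him⟩ := Finset.mem_filter.1 hρ
      obtain ⟨h1, h2, h3, h4, h5⟩ := hS hρS
      rw [abs_of_nonneg him] at h3 h4
      exact ⟨h1, h2, abs_le.2 ⟨by linarith, by linarith⟩, h5⟩
  have hdown := card_zeros_near_height_le hq hfin hκ hA hθ0 hθ1 hAxiomA hAκ hb hb1 (t := -T)
    (by rwa [abs_neg, habs]) (S.filter fun ρ => ¬0 ≤ ρ.im) fun ρ hρ => by
      obtain ⟨hρS, him⟩ := Finset.mem_filter.1 hρ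
      obtain ⟨h1, h2, h3, h4, h5⟩ := hS hρS
      rw [abs_of_neg (not_le.1 him)] at h3 h4
      exact ⟨h1, h2, abs_le.2 ⟨by linarith, by linarith⟩, h5⟩
  rw [abs_neg, habs] at hdown
  rw [habs] at hup
  refine hcard.trans ((add_le_add hup hdown).trans_eq ?_)
  ring
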